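/- arXiv:0802.2689 — 3 statements merged into one kernel-verified Lean document; each statement's English description precedes it below -/
import Mathlib

section
/- Let G be a finite subgroup of PGL(3,C) preserving a smooth plane curve C ⊂ P² and fixing a point P of C. Then G is an extension 1 → G' → G → H → 1 where both G' and H are cyclic; in particular G is abelian and generated by at most 2 elements. -/
open MvPolynomial

/-- The group `PGL(3, ℂ) = GL(3, ℂ)` modulo its center, i.e. `Aut(ℙ²)`. -/
abbrev PGL3 :=
  Matrix.GeneralLinearGroup (Fin 3) ℂ ⧸
    Subgroup.center (Matrix.GeneralLinearGroup (Fin 3) ℂ)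

/-- The differential of `F` at `p`, as a linear functional. -/
noncomputable def gradL (F : MvPolynomial (Fin 3) ℂ) (p : Fin 3 → ℂ) : (Fin 3 → ℂ) →L[ℂ] ℂ :=
  ∑ i : Fin 3, (eval p (pderiv i F)) • ContinuousLinearMap.proj (R := ℂ) (φ := fun _ : Fin 3 => ℂ) i

lemma gradL_apply (F : MvPolynomial (Fin 3) ℂ) (p v : Fin 3 → ℂ) :
    gradL F p v = ∑ i : Fin 3, (eval p (pderiv i F)) * v i := by
  simp [gradL, ContinuousLinearMap.sum_apply]

lemma eval_hasStrictFDerivAt (F : MvPolynomial (Fin 3) ℂ) (p : Fin 3 → ℂ) :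
    HasStrictFDerivAt (fun v => eval v F) (gradL F p) p := by
  induction F using MvPolynomial.induction_on with
  | C a =>
    have : gradL (C a) p = 0 := by ext v; simp [gradL]
    rw [this]
    simpa using hasStrictFDerivAt_const (𝕜 := ℂ) a p
  | add f g hf hg =>
    have : gradL (f + g) p = gradL f p + gradL g p := by
      ext v; simp [gradL_apply, add_mul, Finset.sum_add_distrib]
    rw [this]
    simpa using hf.fun_add hg
  | mul_X f i hf =>
    have hX : HasStrictFDerivAt (fun v : Fin 3 → ℂ => v i)
        (ContinuousLinearMap.proj (R := ℂ) (φ := fun _ : Fin 3 => ℂ) i) p :=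
      (ContinuousLinearMap.proj (R := ℂ) (φ := fun _ : Fin 3 => ℂ) i).hasStrictFDerivAt
    have h := hf.fun_mul hX
    have : gradL (f * X i) p = eval p f • (ContinuousLinearMap.proj (R := ℂ) (φ := fun _ : Fin 3 => ℂ) i) + p i • gradL f p := by
      ext1 v
      simp only [gradL_apply, Derivation.leibniz, pderiv_X, ContinuousLinearMap.add_apply,
        ContinuousLinearMap.smul_apply, ContinuousLinearMap.proj_apply, Fin.sum_univ_three]
      fin_cases i <;> simp [Pi.single_apply] <;> ring
    rw [this]
    simpa using h

lemma eval_smul_homog {F : MvPolynomial (Fin 3) ℂ} {d : ℕ} (hF : F.IsHomogeneous d)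
    (c : ℂ) (v : Fin 3 → ℂ) : eval (c • v) F = c ^ d * eval v F := by
  rw [eval_eq, eval_eq, Finset.mul_sum]
  refine Finset.sum_congr rfl fun m hm => ?_
  have hdeg : ∑ i ∈ m.support, m i = d := by
    have := hF (mem_support_iff.mp hm)
    rw [← this]; simp [Finsupp.weight_apply, Finsupp.sum]
  simp only [Pi.smul_apply, smul_eq_mul, mul_pow, Finset.prod_mul_distrib]
  rw [Finset.prod_pow_eq_pow_sum, hdeg]; ring

lemma gradL_self {F : MvPolynomial (Fin 3) ℂ} {d : ℕ} (hF : F.IsHomogeneous d)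
    {p : Fin 3 → ℂ} (h : eval p F = 0) : gradL F p p = 0 := by
  have := congrArg (eval p) hF.sum_X_mul_pderiv
  rw [gradL_apply]
  simp only [map_sum, map_mul, eval_X, map_nsmul, h, smul_zero] at this
  rw [← this]
  exact Finset.sum_congr rfl fun i _ => mul_comm _ _

/-- A linear map that fixes `p` and preserves the zero set of `F` preserves the tangent space. -/
lemma tangent_preserved (F : MvPolynomial (Fin 3) ℂ) (p : Fin 3 → ℂ)
    (hpC : eval p F = 0) (hne : gradL F p ≠ 0)
    (T : (Fin 3 → ℂ) →L[ℂ] (Fin 3 → ℂ)) (hTp : T p = p)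
    (hT : ∀ v, eval v F = 0 → eval (T v) F = 0) (w : Fin 3 → ℂ) (hw : gradL F p w = 0) :
    gradL F p (T w) = 0 := by
  have hf := (eval_hasStrictFDerivAt F p).restrictScalars ℝ
  have hF2 : HasStrictFDerivAt (fun v => eval (T v) F) ((gradL F p).comp T) p := by
    have h1 := eval_hasStrictFDerivAt F (T p)
    have h2 := h1.comp p T.hasStrictFDerivAt
    rw [hTp] at h2
    exact h2
  have hφ : HasStrictFDerivAt (fun v => (eval (T v) F).re)
      (Complex.reCLM.comp (((gradL F p).comp T).restrictScalars ℝ)) p :=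
    Complex.reCLM.hasStrictFDerivAt.comp p (hF2.restrictScalars ℝ)
  have hext : IsLocalExtrOn (fun v => (eval (T v) F).re) {x | eval x F = eval p F} p := by
    left
    refine Filter.eventually_of_mem self_mem_nhdsWithin ?_
    intro x hx
    have hx' : eval x F = 0 := by rw [← hpC]; exact hx
    simp [hT x hx', hT p hpC]
  obtain ⟨Λ, Λ₀, h0, h⟩ := hext.exists_linear_map_of_hasStrictFDerivAt hf hφ
  have hre : ∀ x, gradL F p x = 0 → (gradL F p (T x)).re = 0 := by
    intro x hx
    have := h x
    simp [hx] at this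
    rcases this with h1 | h1
    · exfalso
      apply h0
      have : Λ = 0 := by
        obtain ⟨u, hu⟩ : ∃ u, gradL F p u ≠ 0 := by
          by_contra hcon
          push Not at hcon
          exact hne (by ext1 v; simpa using hcon v)
        ext1 z
        have hz := h ((z / gradL F p u) • u)
        simpa [h1, hu] using hz
      simp [this, h1]
    · exact h1
  apply Complex.ext
  · exact hre w hw
  · have := hre (Complex.I • w) (by simp [hw])
    simpa using this

/-- A frame adapted to the flag `p ∈ ker ℓ`. -/
lemma exists_frame (l : (Fin 3 → ℂ) →ₗ[ℂ] ℂ) (hl : l ≠ 0) (p : Fin 3 → ℂ) (hp : p ≠ 0)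
    (hlp : l p = 0) : ∃ B : Matrix.GeneralLinearGroup (Fin 3) ℂ,
      (B : Matrix (Fin 3) (Fin 3) ℂ).mulVec (Pi.single 0 1) = p ∧
      l ((B : Matrix (Fin 3) (Fin 3) ℂ).mulVec (Pi.single 1 1)) = 0 ∧
      l ((B : Matrix (Fin 3) (Fin 3) ℂ).mulVec (Pi.single 2 1)) ≠ 0 := by
  obtain ⟨u, hu⟩ : ∃ u, l u ≠ 0 := by
    by_contra hcon
    push Not at hcon
    exact hl (LinearMap.ext hcon)
  obtain ⟨w, hw, hwp⟩ : ∃ w, l w = 0 ∧ w ∉ Submodule.span ℂ {p} := by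
    by_contra hcon
    push Not at hcon
    have hle : LinearMap.ker l ≤ Submodule.span ℂ {p} := fun w hw => hcon w hw
    have h1 := Submodule.finrank_mono hle
    have h2 := finrank_span_singleton (K := ℂ) hp
    have h3 := LinearMap.finrank_range_add_finrank_ker l
    have h4 := Submodule.finrank_le (LinearMap.range l)
    simp at h3 h4
    omega
  let M : Matrix (Fin 3) (Fin 3) ℂ := (Matrix.of ![p, w, u]).transpose
  have hLI : LinearIndependent ℂ ![p, w, u] := by
    rw [Fintype.linearIndependent_iff]
    intro g hg
    simp only [Fin.sum_univ_three, Matrix.cons_val_zero, Matrix.cons_val_one,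
      Matrix.cons_val_two, Matrix.cons_val] at hg
    have g2 : g 2 = 0 := by
      have := congrArg l hg
      simpa [hlp, hw, hu] using this
    rw [g2, zero_smul, add_zero] at hg
    have g1 : g 1 = 0 := by
      by_contra h1
      apply hwp
      rw [Submodule.mem_span_singleton]
      refine ⟨-(g 0 / g 1), ?_⟩
      have : g 1 • w = - (g 0 • p) := eq_neg_of_add_eq_zero_right hg
      calc -(g 0 / g 1) • p = (g 1)⁻¹ • (-(g 0 • p)) := by
            rw [smul_neg, smul_smul, neg_smul, div_eq_inv_mul]
        _ = w := by rw [← this, smul_smul, inv_mul_cancel₀ h1, one_smul]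
    rw [g1, zero_smul, add_zero] at hg
    have g0 : g 0 = 0 := (smul_eq_zero.mp hg).resolve_right hp
    intro i
    fin_cases i
    exacts [g0, g1, g2]
  have hM : IsUnit M := by
    rw [← Matrix.linearIndependent_cols_iff_isUnit]
    exact hLI
  obtain ⟨B, hB⟩ := hM
  have e0 : M.mulVec (Pi.single 0 1) = p := by rw [Matrix.mulVec_single_one]; rfl
  have e1 : M.mulVec (Pi.single 1 1) = w := by rw [Matrix.mulVec_single_one]; rfl
  have e2 : M.mulVec (Pi.single 2 1) = u := by rw [Matrix.mulVec_single_one]; rfl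
  refine ⟨B, ?_, ?_, ?_⟩
  · rw [hB, e0]
  · rw [hB, e1, hw]
  · rw [hB, e2]; exact hu

/-- Upper triangular `3 × 3` matrices. -/
def UT (M : Matrix (Fin 3) (Fin 3) ℂ) : Prop := M 1 0 = 0 ∧ M 2 0 = 0 ∧ M 2 1 = 0

lemma UT.diag_mul {M N : Matrix (Fin 3) (Fin 3) ℂ} (hM : UT M) (hN : UT N) (i : Fin 3) :
    (M * N) i i = M i i * N i i := by
  obtain ⟨a, b, c⟩ := hM
  obtain ⟨a', b', c'⟩ := hN
  rw [Matrix.mul_apply, Fin.sum_univ_three]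
  fin_cases i <;> simp [*]

lemma UT.diag_ne_zero {M : Matrix (Fin 3) (Fin 3) ℂ} (hM : UT M) (h : M.det ≠ 0) (i : Fin 3) :
    M i i ≠ 0 := by
  obtain ⟨a, b, c⟩ := hM
  rw [Matrix.det_fin_three] at h
  simp [a, b, c] at h
  fin_cases i
  exacts [h.1.1, h.1.2, h.2]

lemma UT.pow_formula {M : Matrix (Fin 3) (Fin 3) ℂ} (hM : UT M)
    (h1 : M 1 1 = M 0 0) (h2 : M 2 2 = M 0 0) (k : ℕ) :
    UT (M ^ (k + 1)) ∧ (∀ i, (M ^ (k + 1)) i i = M 0 0 ^ (k + 1)) ∧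
    (M ^ (k + 1)) 0 1 = (k + 1) * M 0 0 ^ k * M 0 1 ∧
    (M ^ (k + 1)) 1 2 = (k + 1) * M 0 0 ^ k * M 1 2 ∧
    (M 0 1 = 0 → (M ^ (k + 1)) 0 2 = (k + 1) * M 0 0 ^ k * M 0 2) := by
  induction k with
  | zero =>
    refine ⟨by simpa using hM, ?_, by simp, by simp, by simp⟩
    intro i; fin_cases i <;> simp [h1, h2]
  | succ k ih =>
    obtain ⟨hU, hd, h01, h12, h02⟩ := ih
    obtain ⟨a, b, c⟩ := hM
    obtain ⟨a', b', c'⟩ := hU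
    have d0 := hd 0
    have d1 := hd 1
    have d2 := hd 2
    rw [pow_succ M (k + 1)]
    generalize M ^ (k + 1) = Q at *
    refine ⟨⟨?_, ?_, ?_⟩, ?_, ?_, ?_, ?_⟩
    · simp [Matrix.mul_apply, Fin.sum_univ_three, *]
    · simp [Matrix.mul_apply, Fin.sum_univ_three, *]
    · simp [Matrix.mul_apply, Fin.sum_univ_three, *]
    · intro i
      fin_cases i <;> simp [Matrix.mul_apply, Fin.sum_univ_three, *] <;> ring
    · rw [Matrix.mul_apply, Fin.sum_univ_three, c, h1, d0, h01]; push_cast; ring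
    · rw [Matrix.mul_apply, Fin.sum_univ_three, a', h2, d1, h12]; push_cast; ring
    · intro hz
      rw [Matrix.mul_apply, Fin.sum_univ_three, h2, d0, h01, h02 hz, hz]; push_cast; ring

lemma UT.scalar_of_pow {M : Matrix (Fin 3) (Fin 3) ℂ} (hM : UT M) (h0 : M 0 0 ≠ 0)
    (h1 : M 1 1 = M 0 0) (h2 : M 2 2 = M 0 0) (k : ℕ) (c : ℂ)
    (h : M ^ (k + 1) = Matrix.scalar (Fin 3) c) : M = Matrix.scalar (Fin 3) (M 0 0) := by
  obtain ⟨-, -, h01, h12, h02⟩ := hM.pow_formula h1 h2 k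
  rw [h] at h01 h12 h02
  have hk : ((k : ℂ) + 1) * M 0 0 ^ k ≠ 0 := mul_ne_zero (by exact_mod_cast Nat.succ_ne_zero k) (pow_ne_zero _ h0)
  have z01 : M 0 1 = 0 := by simpa [hk, Matrix.diagonal_apply, eq_comm] using h01
  have z12 : M 1 2 = 0 := by
    have : 0 = ((k : ℂ) + 1) * M 0 0 ^ k * M 1 2 := by simpa [Matrix.diagonal_apply] using h12
    exact (mul_eq_zero.mp this.symm).resolve_left hk
  have z02 : M 0 2 = 0 := by
    have : 0 = ((k : ℂ) + 1) * M 0 0 ^ k * M 0 2 := by simpa [Matrix.diagonal_apply] using h02 z01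
    exact (mul_eq_zero.mp this.symm).resolve_left hk
  obtain ⟨a, b, c⟩ := hM
  ext i j
  fin_cases i <;> fin_cases j <;> simp [*, Matrix.diagonal_apply]

/-- The abstract group theory: two characters with trivial common kernel. -/
lemma group_part {G : Type*} [Group G] [Finite G] (χ₁ χ₂ : G →* ℂ)
    (hinj : ∀ g, χ₁ g = 1 → χ₂ g = 1 → g = 1) :
    ∃ N : Subgroup G, N.Normal ∧ IsCyclic N ∧
      (∃ (n : ℕ) (π : G →* Multiplicative (ZMod n)),
        Function.Surjective π ∧ π.ker = N) ∧
      (∀ x y : G, x * y = y * x) ∧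
      (∃ x y : G, Subgroup.closure {x, y} = (⊤ : Subgroup G)) := by
  let ψ : G →* ℂˣ := χ₁.toHomUnits
  have hψ : ∀ g, (ψ g : ℂ) = χ₁ g := fun g => rfl
  have hcyc : IsCyclic ψ.ker := by
    refine isCyclic_of_injective_ringHom (χ₂.comp ψ.ker.subtype) ?_
    rw [injective_iff_map_eq_one]
    rintro ⟨g, hg⟩ h
    exact Subtype.ext (hinj g (by
      have := congrArg Units.val (MonoidHom.mem_ker.mp hg)
      simpa [hψ] using this) h)
  have hcyc2 : IsCyclic (G ⧸ ψ.ker) := by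
    refine isCyclic_of_injective_ringHom ((Units.coeHom ℂ).comp (QuotientGroup.kerLift ψ)) ?_
    exact Units.val_injective.comp (QuotientGroup.kerLift_injective ψ)
  refine ⟨ψ.ker, inferInstance, hcyc, ?_, ?_, ?_⟩
  · let e := zmodCyclicMulEquiv hcyc2
    refine ⟨_, e.symm.toMonoidHom.comp (QuotientGroup.mk' ψ.ker), ?_, ?_⟩
    · exact e.symm.surjective.comp (QuotientGroup.mk'_surjective _)
    · ext g
      simp [MonoidHom.mem_ker]
  · intro x y
    have : x * y * (y * x)⁻¹ = 1 := by
      have key : ∀ χ : G →* ℂ, χ (x * y * (y * x)⁻¹) = 1 := by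
        intro χ
        rw [map_mul, map_mul, mul_comm (χ x), ← map_mul, ← map_mul, mul_inv_cancel, map_one]
      exact hinj _ (key _) (key _)
    exact mul_inv_eq_one.mp this
  · obtain ⟨⟨a, ha⟩, hga⟩ := hcyc.exists_generator
    obtain ⟨b', hb⟩ := hcyc2.exists_generator
    obtain ⟨b, rfl⟩ := QuotientGroup.mk_surjective b'
    refine ⟨a, b, ?_⟩
    rw [eq_top_iff]
    intro g _
    obtain ⟨k, hk⟩ := hb (g : G ⧸ ψ.ker)
    have hmem : (b ^ k)⁻¹ * g ∈ ψ.ker := by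
      rw [← QuotientGroup.eq]
      simpa using hk
    obtain ⟨m, hm⟩ := hga ⟨_, hmem⟩
    have hm' : a ^ m = (b ^ k)⁻¹ * g := congrArg Subtype.val hm
    have : g = b ^ k * a ^ m := by rw [hm']; group
    rw [this]
    exact mul_mem (zpow_mem (Subgroup.subset_closure (by simp)) _)
      (zpow_mem (Subgroup.subset_closure (by simp)) _)

lemma lift_rel {A A' : Matrix.GeneralLinearGroup (Fin 3) ℂ}
    (h : (QuotientGroup.mk A : PGL3) = QuotientGroup.mk A') :
    ∃ c : ℂ, c ≠ 0 ∧ (A' : Matrix (Fin 3) (Fin 3) ℂ) = c • (A : Matrix (Fin 3) (Fin 3) ℂ) := by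
  rw [QuotientGroup.eq, Matrix.GeneralLinearGroup.mem_center_iff_val_mem_range_scalar] at h
  obtain ⟨c, hc⟩ := h
  have h1 : (A' : Matrix (Fin 3) (Fin 3) ℂ) = c • (A : Matrix (Fin 3) (Fin 3) ℂ) := by
    have : A' = A * (A⁻¹ * A') := by group
    rw [this, Units.val_mul, ← hc]
    ext i j
    simp [mul_comm]
  refine ⟨c, ?_, h1⟩
  rintro rfl
  rw [zero_smul] at h1
  exact A'.ne_zero h1

/-- Let `G` be a finite subgroup of `PGL(3, ℂ)` preserving a smooth plane
curve `C = {F = 0} ⊂ ℙ²` (`F` homogeneous of degree `d ≥ 1`, with nowhere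
vanishing gradient on `C`) and fixing a point `P` of `C` (given by a nonzero
vector `p`).  Then `G` is an extension `1 → G' → G → H → 1` with `G'` and `H`
cyclic (`G'` acting by homotheties on the tangent line of `C` at `P`, `H`
acting on `ℙ(T_P) ≅ ℙ¹` fixing the tangent direction of `C`); in particular
`G` is abelian and generated by at most `2` elements. -/
theorem stmt_6 (G : Subgroup PGL3) [Finite G]
    (F : MvPolynomial (Fin 3) ℂ) (d : ℕ) (hd : 1 ≤ d)
    (hF : F.IsHomogeneous d)
    (hsmooth : ∀ v : Fin 3 → ℂ, v ≠ 0 → eval v F = 0 →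
      ∃ i : Fin 3, eval v (pderiv i F) ≠ 0)
    (p : Fin 3 → ℂ) (hp : p ≠ 0) (hpC : eval p F = 0)
    (hpreserve : ∀ x ∈ G, ∀ A : Matrix.GeneralLinearGroup (Fin 3) ℂ,
      (QuotientGroup.mk A : PGL3) = x →
      ∀ v : Fin 3 → ℂ, eval v F = 0 →
        eval ((↑A : Matrix (Fin 3) (Fin 3) ℂ).mulVec v) F = 0)
    (hfix : ∀ x ∈ G, ∀ A : Matrix.GeneralLinearGroup (Fin 3) ℂ,
      (QuotientGroup.mk A : PGL3) = x →
      ∃ c : ℂ, (↑A : Matrix (Fin 3) (Fin 3) ℂ).mulVec p = c • p) :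
    ∃ N : Subgroup G, N.Normal ∧ IsCyclic N ∧
      (∃ (n : ℕ) (π : G →* Multiplicative (ZMod n)),
        Function.Surjective π ∧ π.ker = N) ∧
      (∀ x y : G, x * y = y * x) ∧
      (∃ x y : PGL3, G = Subgroup.closure {x, y}) := by
  classical
  have hne : gradL F p ≠ 0 := by
    obtain ⟨i, hi⟩ := hsmooth p hp hpC
    intro h
    apply hi
    have := congrArg (fun f => f (Pi.single i 1)) h
    simpa [gradL_apply, Pi.single_apply] using this
  obtain ⟨B, hB0, hB1, hB2⟩ := exists_frame (gradL F p : (Fin 3 → ℂ) →ₗ[ℂ] ℂ)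
    (by intro h; apply hne; ext1 v; exact LinearMap.congr_fun h v) p hp (gradL_self hF hpC)
  let conj : Matrix.GeneralLinearGroup (Fin 3) ℂ → Matrix (Fin 3) (Fin 3) ℂ :=
    fun A => ((B⁻¹ * A * B : Matrix.GeneralLinearGroup (Fin 3) ℂ) : Matrix (Fin 3) (Fin 3) ℂ)
  have hBconj : ∀ A v, (B : Matrix (Fin 3) (Fin 3) ℂ).mulVec ((conj A).mulVec v) =
      (A : Matrix (Fin 3) (Fin 3) ℂ).mulVec ((B : Matrix (Fin 3) (Fin 3) ℂ).mulVec v) := by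
    intro A v
    have : B * (B⁻¹ * A * B) = A * B := by group
    have := congrArg (fun X : Matrix.GeneralLinearGroup (Fin 3) ℂ => (X : Matrix (Fin 3) (Fin 3) ℂ)) this
    simp only [Units.val_mul B, Units.val_mul A B] at this
    rw [Matrix.mulVec_mulVec, Matrix.mulVec_mulVec, ← this]
  have hBinj : Function.Injective (B : Matrix (Fin 3) (Fin 3) ℂ).mulVec :=
    Matrix.mulVec_injective_of_isUnit B.isUnit
  have hUT : ∀ A : Matrix.GeneralLinearGroup (Fin 3) ℂ, (QuotientGroup.mk A : PGL3) ∈ G →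
      UT (conj A) := by
    intro A hA
    obtain ⟨c, hc⟩ := hfix _ hA A rfl
    have hAinj : Function.Injective (A : Matrix (Fin 3) (Fin 3) ℂ).mulVec :=
      Matrix.mulVec_injective_of_isUnit A.isUnit
    have hc0 : c ≠ 0 := by
      rintro rfl
      rw [zero_smul] at hc
      exact hp (hAinj (by rw [hc, Matrix.mulVec_zero]))
    have hcol : (conj A).mulVec (Pi.single 0 1) = c • Pi.single 0 1 := by
      apply hBinj
      rw [hBconj, hB0, hc, Matrix.mulVec_smul, hB0]
    have hT := tangent_preserved F p hpC hne
      (c⁻¹ • LinearMap.toContinuousLinearMap (Matrix.mulVecLin (A : Matrix (Fin 3) (Fin 3) ℂ)))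
      (by simp [hc, hc0])
      (by
        intro v hv
        have := hpreserve _ hA A rfl v hv
        have h2 := eval_smul_homog hF c⁻¹ ((A : Matrix (Fin 3) (Fin 3) ℂ).mulVec v)
        rw [this, mul_zero] at h2
        exact h2)
      _ hB1
    have hT' : gradL F p ((A : Matrix (Fin 3) (Fin 3) ℂ).mulVec
        ((B : Matrix (Fin 3) (Fin 3) ℂ).mulVec (Pi.single 1 1))) = 0 := by
      have h3 : c⁻¹ * gradL F p ((A : Matrix (Fin 3) (Fin 3) ℂ).mulVec
        ((B : Matrix (Fin 3) (Fin 3) ℂ).mulVec (Pi.single 1 1))) = 0 := by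
        rw [← smul_eq_mul, ← map_smul]; exact hT
      exact (mul_eq_zero.mp h3).resolve_left (inv_ne_zero hc0)
    rw [← hBconj] at hT'
    have hdec : (conj A).mulVec (Pi.single 1 1) = (conj A) 0 1 • (Pi.single 0 1 : Fin 3 → ℂ)
        + (conj A) 1 1 • (Pi.single 1 1 : Fin 3 → ℂ) + (conj A) 2 1 • (Pi.single 2 1 : Fin 3 → ℂ) := by
      ext i
      fin_cases i <;> simp
    have hlp := gradL_self hF hpC
    have hB1' : gradL F p ((B : Matrix (Fin 3) (Fin 3) ℂ).mulVec (Pi.single 1 1)) = 0 := hB1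
    rw [hdec, Matrix.mulVec_add, Matrix.mulVec_add, Matrix.mulVec_smul, Matrix.mulVec_smul,
      Matrix.mulVec_smul, hB0, map_add, map_add, map_smul, map_smul, map_smul, hlp, hB1',
      smul_zero, smul_zero, zero_add, zero_add] at hT'
    refine ⟨?_, ?_, (smul_eq_zero.mp hT').resolve_right hB2⟩
    · simpa using congrFun hcol 1
    · simpa using congrFun hcol 2
  have hdiag : ∀ A : Matrix.GeneralLinearGroup (Fin 3) ℂ, (QuotientGroup.mk A : PGL3) ∈ G →
      ∀ i, conj A i i ≠ 0 := by
    intro A hA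
    refine (hUT A hA).diag_ne_zero ?_
    exact ((Matrix.isUnit_iff_isUnit_det _).mp (B⁻¹ * A * B).isUnit).ne_zero
  have hconj_mul : ∀ A A', conj (A * A') = conj A * conj A' := by
    intro A A'
    simp only [conj]
    rw [← Units.val_mul]
    congr 1
    group
  have hconj_one : conj 1 = 1 := by simp [conj]
  have hconj_pow : ∀ A (n : ℕ), conj (A ^ n) = conj A ^ n := by
    intro A n
    induction n with
    | zero => simpa using hconj_one
    | succ n ih => rw [pow_succ, hconj_mul, ih, pow_succ]
  have hconj_rel : ∀ A A', (QuotientGroup.mk A : PGL3) = QuotientGroup.mk A' →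
      ∃ c : ℂ, c ≠ 0 ∧ conj A' = c • conj A := by
    intro A A' h
    obtain ⟨c, hc, h⟩ := lift_rel h
    refine ⟨c, hc, ?_⟩
    simp only [conj, Units.val_mul, h]
    simp
  let lift : G → Matrix.GeneralLinearGroup (Fin 3) ℂ := fun g => Quotient.out g.1
  have hlift : ∀ g : G, (QuotientGroup.mk (lift g) : PGL3) = g.1 := fun g => QuotientGroup.out_eq' g.1
  let χ : Fin 3 → G → ℂ := fun i g => conj (lift g) i i / conj (lift g) 0 0
  have hχ : ∀ i (g : G) A, (QuotientGroup.mk A : PGL3) = g.1 →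
      χ i g = conj A i i / conj A 0 0 := by
    intro i g A hA
    obtain ⟨c, hc, h⟩ := hconj_rel A (lift g) (by rw [hA, hlift])
    simp only [χ, h, Matrix.smul_apply, smul_eq_mul]
    rw [mul_div_mul_left _ _ hc]
  let Χ : Fin 3 → G →* ℂ := fun i =>
    { toFun := χ i
      map_one' := by
        rw [hχ i 1 1 rfl, hconj_one]; simp
      map_mul' := by
        intro x y
        have hx : (QuotientGroup.mk (lift x) : PGL3) ∈ G := by rw [hlift]; exact x.2
        have hy : (QuotientGroup.mk (lift y) : PGL3) ∈ G := by rw [hlift]; exact y.2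
        rw [hχ i (x * y) (lift x * lift y) (by rw [QuotientGroup.mk_mul, hlift, hlift]; rfl),
          hconj_mul, (hUT _ hx).diag_mul (hUT _ hy), (hUT _ hx).diag_mul (hUT _ hy)]
        exact mul_div_mul_comm _ _ _ _ }
  have hinj : ∀ g, Χ 1 g = 1 → Χ 2 g = 1 → g = 1 := by
    intro g h1 h2
    have hg : (QuotientGroup.mk (lift g) : PGL3) ∈ G := by rw [hlift]; exact g.2
    have h0 := hdiag _ hg 0
    have h1' : conj (lift g) 1 1 = conj (lift g) 0 0 := (div_eq_one_iff_eq h0).mp h1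
    have h2' : conj (lift g) 2 2 = conj (lift g) 0 0 := (div_eq_one_iff_eq h0).mp h2
    obtain ⟨k, hk⟩ : ∃ k, orderOf g = k + 1 := ⟨orderOf g - 1, by have := orderOf_pos g; omega⟩
    have hpow : (QuotientGroup.mk 1 : PGL3) = QuotientGroup.mk (lift g ^ (k + 1)) := by
      rw [QuotientGroup.mk_pow, hlift, ← hk, ← Subgroup.coe_pow, pow_orderOf_eq_one]; rfl
    obtain ⟨c, -, hc⟩ := hconj_rel _ _ hpow
    have hs := (hUT _ hg).scalar_of_pow h0 h1' h2' k c (by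
      rw [← hconj_pow, hc, hconj_one, Matrix.scalar_apply, ← Matrix.smul_one_eq_diagonal])
    have hcen : B⁻¹ * lift g * B ∈ Subgroup.center (Matrix.GeneralLinearGroup (Fin 3) ℂ) := by
      rw [Matrix.GeneralLinearGroup.mem_center_iff_val_mem_range_scalar]
      exact ⟨_, hs.symm⟩
    have hcen2 : lift g ∈ Subgroup.center (Matrix.GeneralLinearGroup (Fin 3) ℂ) := by
      have := (inferInstance : (Subgroup.center
        (Matrix.GeneralLinearGroup (Fin 3) ℂ)).Normal).conj_mem _ hcen B
      have he : B * (B⁻¹ * lift g * B) * B⁻¹ = lift g := by group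
      rwa [he] at this
    apply Subtype.ext
    rw [← hlift g]
    exact (QuotientGroup.eq_one_iff _).mpr hcen2
  obtain ⟨N, hN, hc, hπ, hcomm, x, y, hxy⟩ := group_part (Χ 1) (Χ 2) hinj
  refine ⟨N, hN, hc, hπ, hcomm, x.1, y.1, ?_⟩
  have := congrArg (Subgroup.map G.subtype) hxy
  rw [MonoidHom.map_closure, ← MonoidHom.range_eq_map, Subgroup.range_subtype] at this
  rw [Set.image_pair] at this
  exact this.symm
end

section
/- Let D = aK + bf be an integral divisor class on a surface S with intersection numbers K² = 8 − k (k ≥ 1), K·f = −2, f² = 0. If D² = D·K = −l with l ∈ {1,2,4} and D·f ≥ 0 (so a ≤ 0), then the only integer solutions (l, a, b, k) satisfy k ∈ {2, 3, 5}: namely (l,a,b) ∈ {(1,−1,−1), (2,−1,−2), (4,−1,−4), (4,−2,−3)} with K² = 3, 6, 12, 5 respectively. -/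
/-- The purely arithmetic core of the minimality lemma for conic bundles:
in the lattice `ℤ·K ⊕ ℤ·f` with Gram matrix `[[8 - k, -2], [-2, 0]]`
(so `K² = 8 - k`, `K·f = -2`, `f² = 0`), for a class `D = a•K + b•f` the
conditions `D² = D·K = -l` with `l ∈ {1,2,4}` and `a ≤ 0` force
`(l,a,b) ∈ {(1,-1,-1), (2,-1,-2), (4,-1,-4), (4,-2,-3)}`
(with `K² = 3, 6, 12, 5` respectively), and hence `k ∈ {2, 3, 5}`. -/
theorem stmt_8 (k a b l : ℤ) (hk : 1 ≤ k)
    (hl : l = 1 ∨ l = 2 ∨ l = 4) (ha : a ≤ 0)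
    (hD2 : a ^ 2 * (8 - k) - 4 * (a * b) = -l)
    (hDK : a * (8 - k) - 2 * b = -l) :
    ((l = 1 ∧ a = -1 ∧ b = -1) ∨ (l = 2 ∧ a = -1 ∧ b = -2) ∨
      (l = 4 ∧ a = -1 ∧ b = -4) ∨ (l = 4 ∧ a = -2 ∧ b = -3)) ∧
    (k = 2 ∨ k = 3 ∨ k = 5) := by
  have h : a * (a * (8 - k) + 2 * l) = l := by linear_combination 2 * a * hDK - hD2
  have hdvd : a ∣ l := ⟨_, h.symm⟩
  have hge : -4 ≤ a := by
    have h1 : -a ≤ l := Int.le_of_dvd (by omega) (neg_dvd.mpr hdvd)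
    omega
  clear hdvd hD2
  interval_cases a <;> omega
end

section
/- The map det: PGL(2, C(x)) → C(x)*/(C(x)*)² induces a bijection, via V ↦ det(V), between conjugacy classes of subgroups V of PGL(2, C(x)) isomorphic to (Z/2)² and subgroups of C(x)*/(C(x)*)² of order ≤ 4. -/
/-- The field `ℂ(x)` of rational functions. -/
abbrev Kx := RatFunc ℂ

/-- The group `PGL(2, ℂ(x)) = GL(2, ℂ(x))` modulo its center. -/
abbrev PGL2Kx :=
  Matrix.GeneralLinearGroup (Fin 2) Kx ⧸
    Subgroup.center (Matrix.GeneralLinearGroup (Fin 2) Kx)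

/-- The subgroup of squares in `ℂ(x)*`. -/
noncomputable abbrev sqSubgroup : Subgroup Kxˣ :=
  (powMonoidHom 2 : Kxˣ →* Kxˣ).range

/-- The determinant `PGL(2, ℂ(x)) → ℂ(x)*/(ℂ(x)*)²` (well defined since
rescaling a matrix by `λ` multiplies its determinant by `λ²`); it is computed
on an arbitrary lift. -/
noncomputable def detBar (x : PGL2Kx) : Kxˣ ⧸ sqSubgroup :=
  QuotientGroup.mk (Matrix.GeneralLinearGroup.det (Quotient.out x))

/-- `V` is a Klein four-group. -/
def IsKlein4Subgroup (V : Subgroup PGL2Kx) : Prop :=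
  Nonempty (V ≃* (Multiplicative (ZMod 2) × Multiplicative (ZMod 2)))

open Polynomial in
lemma poly_sq_mod (a b : ℂ[X]) (hb : Squarefree b) : ∃ c : ℂ[X], b ∣ c ^ 2 - a ∧ c.degree < b.degree := by
  classical
  have hb0 : b ≠ 0 := hb.ne_zero
  have hnd : b.roots.Nodup := Polynomial.nodup_roots (PerfectField.separable_iff_squarefree.mpr hb)
  choose s hs using fun z : ℂ => IsAlgClosed.exists_pow_nat_eq z (n := 2) (by norm_num)
  have hinj : Set.InjOn (id : ℂ → ℂ) (b.roots.toFinset : Set ℂ) := fun _ _ _ _ h => h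
  let c := Lagrange.interpolate b.roots.toFinset id (fun r => s (a.eval r))
  refine ⟨c, ?_, ?_⟩
  · by_cases h0 : c ^ 2 - a = 0
    · rw [h0]; exact dvd_zero _
    have hle : b.roots ≤ (c ^ 2 - a).roots := by
      rw [Multiset.le_iff_subset hnd]
      intro r hr
      rw [mem_roots h0]
      have := Lagrange.eval_interpolate_at_node (r := fun r => s (a.eval r)) hinj
        (i := r) (by simpa using hr)
      simp only [id] at this
      simp only [IsRoot.def, eval_sub, eval_pow]
      change eval r c = _ at this
      rw [this, hs, sub_self]
    exact (IsAlgClosed.splits b).dvd_of_roots_le_roots hb0 hle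
  · have h := Lagrange.degree_interpolate_lt (fun r => s (a.eval r)) hinj
    have hc : b.roots.toFinset.card = b.natDegree := by
      rw [Multiset.toFinset_card_of_nodup hnd, IsAlgClosed.card_roots_eq_natDegree]
    rw [hc] at h
    rw [degree_eq_natDegree hb0]
    exact h

open Polynomial in
lemma tsen_poly (n : ℕ) : ∀ a b : ℂ[X], a ≠ 0 → b ≠ 0 → a.natDegree + b.natDegree ≤ n →
    ∃ x y z : ℂ[X], ¬ (x = 0 ∧ y = 0 ∧ z = 0) ∧ x ^ 2 = a * y ^ 2 + b * z ^ 2 := by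
  induction n using Nat.strong_induction_on with
  | _ n ih =>
  have key : ∀ a b : ℂ[X], a ≠ 0 → b ≠ 0 → a.natDegree + b.natDegree ≤ n →
      a.natDegree ≤ b.natDegree →
      ∃ x y z : ℂ[X], ¬ (x = 0 ∧ y = 0 ∧ z = 0) ∧ x ^ 2 = a * y ^ 2 + b * z ^ 2 := by
    intro a b ha hb hn hab
    by_cases hd : b.natDegree = 0
    · obtain ⟨k, rfl⟩ := natDegree_eq_zero.mp hd
      obtain ⟨s, hs⟩ := IsAlgClosed.exists_pow_nat_eq k (n := 2) (by norm_num)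
      refine ⟨C s, 0, 1, by simp, ?_⟩
      rw [← hs]; simp
    by_cases hsf : Squarefree b
    · obtain ⟨c, ⟨e, he⟩, hc⟩ := poly_sq_mod a b hsf
      by_cases he0 : e = 0
      · refine ⟨c, 1, 0, by simp, ?_⟩
        rw [he0] at he
        linear_combination he
      have hcd : c.natDegree < b.natDegree :=
        by
          by_cases hc0 : c = 0
          · rw [hc0, natDegree_zero]; omega
          · exact natDegree_lt_natDegree hc0 hc
      have hdeg : b.natDegree + e.natDegree < 2 * b.natDegree := by
        rw [← natDegree_mul hb he0, ← he]
        refine lt_of_le_of_lt (natDegree_sub_le _ _) ?_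
        have := natDegree_pow c 2
        rw [max_lt_iff]
        constructor <;> omega
      obtain ⟨x, y, z, h0, h⟩ := ih (a.natDegree + e.natDegree) (by omega) a e ha he0 le_rfl
      by_cases hz : z = 0
      · exact ⟨x, y, 0, by rw [hz] at h0; exact h0, by rw [h, hz]; ring⟩
      · refine ⟨x * c + a * y, x + c * y, e * z, fun h => mul_ne_zero he0 hz h.2.2, ?_⟩
        linear_combination (c^2 - a) * h + e * z^2 * he
    · rw [squarefree_iff_irreducible_sq_not_dvd_of_ne_zero hb] at hsf
      push Not at hsf
      obtain ⟨d, hdi, e, rfl⟩ := hsf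
      have hd0 := hdi.ne_zero
      have he0 : e ≠ 0 := right_ne_zero_of_mul hb
      have h1 := hdi.natDegree_pos
      have h2 := natDegree_mul (mul_ne_zero hd0 hd0) he0
      have h3 := natDegree_mul hd0 hd0
      obtain ⟨x, y, z, h0, h⟩ := ih (a.natDegree + e.natDegree) (by omega) a e ha he0 le_rfl
      refine ⟨d * x, d * y, z, ?_, ?_⟩
      · simpa [hd0] using h0
      · linear_combination d^2 * h
  intro a b ha hb hn
  rcases le_total a.natDegree b.natDegree with hab | hab
  · exact key a b ha hb hn hab
  · obtain ⟨x, y, z, h0, h⟩ := key b a hb ha (by omega) hab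
    exact ⟨x, z, y, by tauto, by rw [h]; ring⟩

/-- Tsen: every nonzero element is a norm. -/
lemma tsen_norm (a b : Kx) (ha : a ≠ 0) (hb : b ≠ 0) : ∃ x y : Kx, b = x ^ 2 - a * y ^ 2 := by
  have univ : ∀ r : Kx, r ≠ 0 → a = r ^ 2 → ∃ x y : Kx, b = x ^ 2 - a * y ^ 2 := by
    intro r hr h
    refine ⟨(b + 1) / 2, (b - 1) / (2 * r), ?_⟩
    rw [h]; field_simp; ring
  obtain ⟨p, q, hq, rfl⟩ := IsFractionRing.div_surjective (A := Polynomial ℂ) a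
  obtain ⟨p', q', hq', rfl⟩ := IsFractionRing.div_surjective (A := Polynomial ℂ) b
  have hq0 := nonZeroDivisors.ne_zero hq
  have hq0' := nonZeroDivisors.ne_zero hq'
  have inj : Function.Injective (algebraMap (Polynomial ℂ) Kx) := IsFractionRing.injective _ _
  have hne : ∀ f : Polynomial ℂ, algebraMap (Polynomial ℂ) Kx f = 0 ↔ f = 0 := fun f =>
    map_eq_zero_iff _ inj
  have hp0 : p ≠ 0 := by rintro rfl; simp at ha
  have hp0' : p' ≠ 0 := by rintro rfl; simp at hb
  obtain ⟨x, y, z, h0, h⟩ := tsen_poly _ (p * q) (p' * q') (mul_ne_zero hp0 hq0)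
    (mul_ne_zero hp0' hq0') le_rfl
  have h' := congrArg (algebraMap (Polynomial ℂ) Kx) h
  simp only [map_mul, map_add, map_pow] at h'
  have nq := (hne q).not.mpr hq0
  have nq' := (hne q').not.mpr hq0'
  have np := (hne p).not.mpr hp0
  have nx := hne x
  have ny := hne y
  have nz := hne z
  generalize algebraMap (Polynomial ℂ) Kx x = X at *
  generalize algebraMap (Polynomial ℂ) Kx y = Y at *
  generalize algebraMap (Polynomial ℂ) Kx z = Z at *
  generalize algebraMap (Polynomial ℂ) Kx q = Q at *
  generalize algebraMap (Polynomial ℂ) Kx q' = Q' at *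
  generalize algebraMap (Polynomial ℂ) Kx p = P at *
  generalize algebraMap (Polynomial ℂ) Kx p' = P' at *
  by_cases hZ : Z = 0
  · have hY : Y ≠ 0 := by
      intro hY
      rw [hY, hZ] at h'
      have : X = 0 := by simpa using h'
      tauto
    have hX : X ≠ 0 := by
      intro hX
      rw [hX, hZ] at h'
      have : P * Q * Y ^ 2 = 0 := by linear_combination -h'
      simp_all
    apply univ (X / (Q * Y)) (by positivity)
    rw [hZ] at h'
    field_simp
    linear_combination -h'
  · refine ⟨X / (Q' * Z), Q * Y / (Q' * Z), ?_⟩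
    field_simp
    linear_combination -h'

open Matrix in
lemma nf_mat {F : Type*} [Field F] (h2 : (2 : F) ≠ 0) (a b x y : F) (ha : a ≠ 0) (hb : b ≠ 0)
    (hxy : b = x ^ 2 - a * y ^ 2) (A B : Matrix (Fin 2) (Fin 2) F)
    (hA : A * A = a • 1) (hB : B * B = b • 1) (hAB : A * B = -(B * A)) :
    ∃ P : Matrix (Fin 2) (Fin 2) F, P.det ≠ 0 ∧ A * P = P * !![0, a; 1, 0] ∧
      B * P = P * !![x, y * a; -y, -x] := by
  have hne : A * B ≠ 0 := by
    intro h
    have h1 : A * (A * B) * B = 0 := by rw [h]; simp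
    have h3 : A * (A * B) * B = (A * A) * (B * B) := by simp only [Matrix.mul_assoc]
    rw [h3, hA, hB] at h1
    have := congrFun (congrFun h1 0) 0
    simp [ha, hb] at this
  have hdet : (x • (1 : Matrix (Fin 2) (Fin 2) F) - y • A - B).det = 0 := by
    by_contra hd
    have hM : (x • (1 : Matrix (Fin 2) (Fin 2) F) - y • A - B) * (x • 1 + y • A + B) = 0 := by
      have : (x • (1 : Matrix (Fin 2) (Fin 2) F) - y • A - B) * (x • 1 + y • A + B) =
          (x ^ 2) • 1 - (y ^ 2) • (A * A) - B * B - y • (A * B + B * A) := by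
        simp only [mul_add, sub_mul, smul_mul_assoc, mul_smul_comm, one_mul, mul_one]
        module
      rw [this, hA, hB, hAB, hxy]
      simp only [neg_add_cancel]
      module
    have h0 : x • 1 + y • A + B = 0 := by
      have hu : IsUnit (x • (1 : Matrix (Fin 2) (Fin 2) F) - y • A - B) :=
        (Matrix.isUnit_iff_isUnit_det _).mpr (isUnit_iff_ne_zero.mpr hd)
      exact hu.mul_right_eq_zero.mp hM
    have hBe : B = -(x • 1 + y • A) := by
      rw [eq_neg_iff_add_eq_zero, add_comm]; exact h0
    have hcomm : A * B = B * A := by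
      rw [hBe]; simp [mul_add, add_mul]
    apply hne
    have h4 : (2 : F) • (A * B) = 0 := by
      rw [two_smul]
      nth_rewrite 1 [hAB]
      rw [hcomm]; simp
    exact (smul_eq_zero.mp h4).resolve_left h2
  obtain ⟨v, hv0, hv⟩ := Matrix.exists_mulVec_eq_zero_iff.mpr hdet
  have hBv : B *ᵥ v = x • v - y • (A *ᵥ v) := by
    rw [Matrix.sub_mulVec, Matrix.sub_mulVec, Matrix.smul_mulVec, Matrix.smul_mulVec,
      Matrix.one_mulVec] at hv
    exact (sub_eq_zero.mp hv).symm
  have hAAv : A *ᵥ (A *ᵥ v) = a • v := by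
    rw [Matrix.mulVec_mulVec, hA, Matrix.smul_mulVec, Matrix.one_mulVec]
  have hABv : B *ᵥ (A *ᵥ v) = -(A *ᵥ (B *ᵥ v)) := by
    rw [Matrix.mulVec_mulVec, Matrix.mulVec_mulVec, hAB, Matrix.neg_mulVec, neg_neg]
  have hBAv : B *ᵥ (A *ᵥ v) = (y * a) • v - x • (A *ᵥ v) := by
    rw [hABv, hBv, Matrix.mulVec_sub, Matrix.mulVec_smul, Matrix.mulVec_smul, hAAv]
    module
  have hBBv : B *ᵥ (B *ᵥ v) = b • v := by
    rw [Matrix.mulVec_mulVec, hB, Matrix.smul_mulVec, Matrix.one_mulVec]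
  have heig : ∀ μ : F, A *ᵥ v ≠ μ • v := by
    intro μ hμ
    have e1 : (μ * μ) • v = a • v := by
      rw [← hAAv, hμ, Matrix.mulVec_smul, hμ, smul_smul]
    have e2 : B *ᵥ v = (x - y * μ) • v := by rw [hBv, hμ]; module
    have e3 : ((x - y * μ) * (x - y * μ)) • v = b • v := by
      rw [← hBBv, e2, Matrix.mulVec_smul, e2, smul_smul]
    have e4 : (2 * μ * (x - y * μ)) • v = 0 := by
      have := hABv
      rw [e2, hμ, Matrix.mulVec_smul, Matrix.mulVec_smul, hμ, e2] at this
      rw [eq_neg_iff_add_eq_zero] at this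
      rw [← this]; module
    have e1' := smul_left_injective F hv0 e1
    have e3' := smul_left_injective F hv0 e3
    have e4' := (smul_eq_zero.mp e4).resolve_right hv0
    rcases mul_eq_zero.mp e4' with h | h
    · have : μ = 0 := (mul_eq_zero.mp h).resolve_left h2
      apply ha; rw [← e1', this]; simp
    · apply hb; rw [← e3', h]; simp
  generalize hw : A *ᵥ v = w at *
  refine ⟨!![v 0, w 0; v 1, w 1], ?_, ?_, ?_⟩
  · rw [Matrix.det_fin_two_of]
    intro hd
    by_cases h0 : v 0 = 0
    · have h1 : v 1 ≠ 0 := by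
        intro h1; apply hv0; ext i; fin_cases i <;> simp [h0, h1]
      apply heig (w 1 / v 1)
      ext i; fin_cases i
      · simp [h0]
        rw [h0] at hd
        have : w 0 * v 1 = 0 := by linear_combination -hd
        exact (mul_eq_zero.mp this).resolve_right h1
      · simp [h1]
    · apply heig (w 0 / v 0)
      ext i; fin_cases i
      · simp [h0]
      · simp; field_simp; linear_combination hd
  · have a0 := congrFun hw 0
    have a1 := congrFun hw 1
    have b0 := congrFun hAAv 0
    have b1 := congrFun hAAv 1
    simp only [Matrix.mulVec, dotProduct, Fin.sum_univ_two, Pi.smul_apply, smul_eq_mul] at a0 a1 b0 b1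
    ext i j; fin_cases i <;> fin_cases j <;> simp [Matrix.mul_apply, Fin.sum_univ_two]
    · exact a0
    · rw [b0]; ring
    · exact a1
    · rw [b1]; ring
  · have a0 := congrFun hBv 0
    have a1 := congrFun hBv 1
    have b0 := congrFun hBAv 0
    have b1 := congrFun hBAv 1
    simp only [Matrix.mulVec, dotProduct, Fin.sum_univ_two, Pi.smul_apply, smul_eq_mul,
      Pi.sub_apply] at a0 a1 b0 b1
    ext i j; fin_cases i <;> fin_cases j <;> simp [Matrix.mul_apply, Fin.sum_univ_two]
    · linear_combination a0
    · linear_combination b0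
    · linear_combination a1
    · linear_combination b1

lemma two_ne_zero_Kx : (2 : Kx) ≠ 0 := two_ne_zero

lemma mem_center_iff_smul (A : Matrix.GeneralLinearGroup (Fin 2) Kx) :
    A ∈ Subgroup.center (Matrix.GeneralLinearGroup (Fin 2) Kx) ↔
      ∃ c : Kx, (A : Matrix (Fin 2) (Fin 2) Kx) = c • 1 := by
  rw [Matrix.GeneralLinearGroup.mem_center_iff_val_mem_range_scalar]
  constructor
  · rintro ⟨c, hc⟩
    exact ⟨c, by rw [← hc, Matrix.smul_one_eq_diagonal]; rfl⟩
  · rintro ⟨c, hc⟩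
    exact ⟨c, by rw [hc, Matrix.smul_one_eq_diagonal]; rfl⟩

/-- The determinant homomorphism on `PGL`. -/
noncomputable def detHom : PGL2Kx →* Kxˣ ⧸ sqSubgroup :=
  QuotientGroup.lift _ ((QuotientGroup.mk' sqSubgroup).comp Matrix.GeneralLinearGroup.det) (by
    intro A hA
    obtain ⟨c, hc⟩ := (mem_center_iff_smul A).mp hA
    have hd : (Matrix.GeneralLinearGroup.det A : Kx) = c ^ 2 := by
      rw [Matrix.GeneralLinearGroup.val_det_apply, hc, Matrix.det_smul]; simp
    have hc0 : c ≠ 0 := by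
      rintro rfl
      exact (Matrix.GeneralLinearGroup.det A).ne_zero (by rw [hd]; simp)
    rw [MonoidHom.mem_ker, MonoidHom.comp_apply, QuotientGroup.mk'_apply,
      QuotientGroup.eq_one_iff]
    refine ⟨Units.mk0 c hc0, ?_⟩
    ext
    simp only [powMonoidHom_apply, Units.val_pow_eq_pow_val, Units.val_mk0]
    exact hd.symm)

lemma detHom_mk (A : Matrix.GeneralLinearGroup (Fin 2) Kx) :
    detHom (QuotientGroup.mk A) = QuotientGroup.mk (Matrix.GeneralLinearGroup.det A) := rfl

lemma detBar_eq : detBar = detHom := by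
  funext x
  have : x = QuotientGroup.mk (Quotient.out x) := (QuotientGroup.out_eq' x).symm
  conv_rhs => rw [this]
  rfl

/-- Scalar elements of `GL`. -/
noncomputable def scal (c : Kxˣ) : Matrix.GeneralLinearGroup (Fin 2) Kx :=
  Matrix.GeneralLinearGroup.mkOfDetNeZero ((c : Kx) • 1) (by
    rw [Matrix.det_smul]; simp)

lemma exists_lift (u : PGL2Kx) (α : Kxˣ) (h : detHom u = QuotientGroup.mk α) :
    ∃ A : Matrix.GeneralLinearGroup (Fin 2) Kx, QuotientGroup.mk A = u ∧
      (A : Matrix (Fin 2) (Fin 2) Kx).det = α := by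
  obtain ⟨A, rfl⟩ := QuotientGroup.mk_surjective u
  rw [detHom_mk, QuotientGroup.eq] at h
  obtain ⟨c, hc⟩ := h
  refine ⟨A * scal c, ?_, ?_⟩
  · rw [QuotientGroup.mk_mul]
    have : (QuotientGroup.mk (scal c) : PGL2Kx) = 1 := by
      rw [QuotientGroup.eq_one_iff, mem_center_iff_smul]
      exact ⟨c, rfl⟩
    rw [this, mul_one]
  · have h1 : α = Matrix.GeneralLinearGroup.det A * c ^ 2 := by
      rw [show c ^ 2 = _ from hc]; simp
    rw [h1]
    change ((A : Matrix (Fin 2) (Fin 2) Kx) * ((c : Kx) • 1)).det = _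
    rw [Matrix.det_mul, Matrix.det_smul]
    simp

lemma sq_of_invol (A : Matrix.GeneralLinearGroup (Fin 2) Kx)
    (h1 : (QuotientGroup.mk A : PGL2Kx) ≠ 1)
    (h2 : (QuotientGroup.mk A : PGL2Kx) * QuotientGroup.mk A = 1) :
    (A : Matrix (Fin 2) (Fin 2) Kx) * A = (-(A : Matrix (Fin 2) (Fin 2) Kx).det) • 1 := by
  rw [Ne, QuotientGroup.eq_one_iff, mem_center_iff_smul] at h1
  rw [← QuotientGroup.mk_mul, QuotientGroup.eq_one_iff, mem_center_iff_smul] at h2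
  obtain ⟨c, hc⟩ := h2
  rw [Matrix.GeneralLinearGroup.coe_mul] at hc
  generalize (A : Matrix (Fin 2) (Fin 2) Kx) = M at *
  have ch : M * M = M.trace • M - M.det • 1 := by
    ext i j
    fin_cases i <;> fin_cases j <;>
      simp [Matrix.mul_apply, Fin.sum_univ_two, Matrix.trace_fin_two, Matrix.det_fin_two] <;> ring
  by_cases ht : M.trace = 0
  · rw [ch, ht, zero_smul, zero_sub, neg_smul]
  · exfalso
    apply h1
    refine ⟨(c + M.det) / M.trace, ?_⟩
    have h3 : M.trace • M = (c + M.det) • 1 := by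
      rw [add_smul, ← hc, ch, sub_add_cancel]
    rw [div_eq_inv_mul, mul_smul, ← h3, smul_smul, inv_mul_cancel₀ ht, one_smul]

/-- generators of a Klein four group -/
structure KPair {G : Type*} [Group G] (u v : G) : Prop where
  uu : u * u = 1
  vv : v * v = 1
  comm : u * v = v * u
  u1 : u ≠ 1
  v1 : v ≠ 1
  uv : u ≠ v

lemma KPair.anti {A B : Matrix.GeneralLinearGroup (Fin 2) Kx}
    (h : KPair (QuotientGroup.mk A : PGL2Kx) (QuotientGroup.mk B)) :
    (A : Matrix (Fin 2) (Fin 2) Kx) * B = -(B * A) := by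
  have hA := sq_of_invol A h.u1 h.uu
  have hB := sq_of_invol B h.v1 h.vv
  have hAB := sq_of_invol (A * B)
    (by
      rw [QuotientGroup.mk_mul]
      intro h'
      apply h.uv
      rw [mul_eq_one_iff_eq_inv] at h'
      rw [h', inv_eq_iff_mul_eq_one, h.vv])
    (by
      rw [QuotientGroup.mk_mul]
      nth_rewrite 1 [h.comm]
      rw [mul_assoc, ← mul_assoc (QuotientGroup.mk A), h.uu, one_mul, h.vv])
  rw [Matrix.GeneralLinearGroup.coe_mul, Matrix.det_mul] at hAB
  have e : (A : Matrix (Fin 2) (Fin 2) Kx) * (B * A) * B = A * (-(A * B)) * B := by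
    have e1 : (A : Matrix (Fin 2) (Fin 2) Kx) * (-(A * B)) * B = -((A * A) * (B * B)) := by
      simp only [Matrix.mul_assoc, mul_neg, neg_mul]
    rw [e1, hA, hB]
    have e2 : (A : Matrix (Fin 2) (Fin 2) Kx) * (B * A) * B = A * B * (A * B) := by
      simp only [Matrix.mul_assoc]
    rw [e2, hAB]
    simp only [smul_mul_assoc, mul_smul_comm, one_mul, smul_smul]
    rw [← neg_smul]
    congr 1
    ring
  have e' := A.isUnit.mul_left_cancel (B.isUnit.mul_right_cancel e)
  rw [e', neg_neg]

/-- The normal forms. -/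
lemma exists_nf (α β : Kxˣ) : ∃ u₀ v₀ : PGL2Kx, KPair u₀ v₀ ∧
    detHom u₀ = QuotientGroup.mk α ∧ detHom v₀ = QuotientGroup.mk β ∧
    ∀ u v : PGL2Kx, KPair u v → detHom u = QuotientGroup.mk α → detHom v = QuotientGroup.mk β →
      ∃ g : PGL2Kx, u * g = g * u₀ ∧ v * g = g * v₀ := by
  have ha : -(α : Kx) ≠ 0 := neg_ne_zero.mpr α.ne_zero
  have hb : -(β : Kx) ≠ 0 := neg_ne_zero.mpr β.ne_zero
  obtain ⟨x, y, hxy⟩ := tsen_norm (-(α : Kx)) (-(β : Kx)) ha hb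
  have dA : (!![0, -(α : Kx); 1, 0]).det = α := by simp [Matrix.det_fin_two_of]
  have dB : (!![x, y * -(α : Kx); -y, -x]).det = β := by
    rw [Matrix.det_fin_two_of]; linear_combination hxy
  let A₀ := Matrix.GeneralLinearGroup.mkOfDetNeZero _ (dA.trans_ne α.ne_zero)
  let B₀ := Matrix.GeneralLinearGroup.mkOfDetNeZero _ (dB.trans_ne β.ne_zero)
  have vA : (A₀ : Matrix (Fin 2) (Fin 2) Kx) = !![0, -(α : Kx); 1, 0] := rfl
  have vB : (B₀ : Matrix (Fin 2) (Fin 2) Kx) = !![x, y * -(α : Kx); -y, -x] := rfl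
  have hAA : (A₀ : Matrix (Fin 2) (Fin 2) Kx) * A₀ = (-(α : Kx)) • 1 := by
    rw [vA]; ext i j; fin_cases i <;> fin_cases j <;> simp
  have hBB : (B₀ : Matrix (Fin 2) (Fin 2) Kx) * B₀ = (-(β : Kx)) • 1 := by
    rw [vB, hxy]; ext i j; fin_cases i <;> fin_cases j <;> simp <;> ring
  have hAB : (A₀ : Matrix (Fin 2) (Fin 2) Kx) * B₀ = -(B₀ * A₀) := by
    rw [vA, vB]; ext i j; fin_cases i <;> fin_cases j <;> simp <;> ring
  have hne : (A₀ : Matrix (Fin 2) (Fin 2) Kx) * B₀ ≠ B₀ * A₀ := by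
    intro h
    have h0 : (2 : Kx) • ((A₀ : Matrix (Fin 2) (Fin 2) Kx) * B₀) = 0 := by
      rw [two_smul]
      nth_rewrite 1 [hAB]
      rw [h]; simp
    have h1 := (smul_eq_zero.mp h0).resolve_left two_ne_zero_Kx
    have h2 := congrArg Matrix.det h1
    rw [Matrix.det_mul, vA, vB, dA, dB] at h2
    simp at h2
  refine ⟨QuotientGroup.mk A₀, QuotientGroup.mk B₀, ⟨?_, ?_, ?_, ?_, ?_, ?_⟩, ?_, ?_, ?_⟩
  · rw [← QuotientGroup.mk_mul, QuotientGroup.eq_one_iff, mem_center_iff_smul]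
    exact ⟨_, hAA⟩
  · rw [← QuotientGroup.mk_mul, QuotientGroup.eq_one_iff, mem_center_iff_smul]
    exact ⟨_, hBB⟩
  · have : A₀ * B₀ = (B₀ * A₀) * scal (-1) := by
      ext1
      change (A₀ : Matrix (Fin 2) (Fin 2) Kx) * B₀ = B₀ * A₀ * (((-1 : Kxˣ) : Kx) • 1)
      rw [hAB]; simp
    rw [← QuotientGroup.mk_mul, this, QuotientGroup.mk_mul, QuotientGroup.mk_mul]
    have : (QuotientGroup.mk (scal (-1)) : PGL2Kx) = 1 := by
      rw [QuotientGroup.eq_one_iff, mem_center_iff_smul]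
      exact ⟨_, rfl⟩
    rw [this, mul_one]
  · rw [Ne, QuotientGroup.eq_one_iff, mem_center_iff_smul]
    rintro ⟨c, hc⟩
    apply hne; rw [hc]; simp
  · rw [Ne, QuotientGroup.eq_one_iff, mem_center_iff_smul]
    rintro ⟨c, hc⟩
    apply hne; rw [hc]; simp
  · rw [Ne, QuotientGroup.eq, mem_center_iff_smul]
    rintro ⟨c, hc⟩
    apply hne
    have : B₀ = A₀ * (A₀⁻¹ * B₀) := by simp
    have h3 : (B₀ : Matrix (Fin 2) (Fin 2) Kx) = A₀ * (c • 1) := by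
      rw [← hc, ← Matrix.GeneralLinearGroup.coe_mul, ← this]
    rw [h3]; simp
  · rw [detHom_mk]; congr 1; ext; exact dA
  · rw [detHom_mk]; congr 1; ext; exact dB
  · intro u v huv hu hv
    obtain ⟨A, rfl, hA⟩ := exists_lift u α hu
    obtain ⟨B, rfl, hB⟩ := exists_lift v β hv
    have h1 := sq_of_invol A huv.u1 huv.uu
    have h2 := sq_of_invol B huv.v1 huv.vv
    rw [hA] at h1
    rw [hB] at h2
    obtain ⟨P, hP, hAP, hBP⟩ := nf_mat two_ne_zero_Kx _ _ x y ha hb hxy _ _ h1 h2 huv.anti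
    refine ⟨QuotientGroup.mk (Matrix.GeneralLinearGroup.mkOfDetNeZero P hP), ?_, ?_⟩
    · rw [← QuotientGroup.mk_mul, ← QuotientGroup.mk_mul]
      congr 1
      ext1
      exact hAP
    · rw [← QuotientGroup.mk_mul, ← QuotientGroup.mk_mul]
      congr 1
      ext1
      exact hBP

section grp
variable {G : Type*} [Group G]

lemma KPair.vu {u v : G} (h : KPair u v) : KPair v u :=
  ⟨h.vv, h.uu, h.comm.symm, h.v1, h.u1, h.uv.symm⟩

lemma KPair.u_uv {u v : G} (h : KPair u v) : u * (u * v) = v := by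
  rw [← mul_assoc, h.uu, one_mul]

lemma KPair.v_uv {u v : G} (h : KPair u v) : v * (u * v) = u := by
  rw [h.comm, ← mul_assoc, h.vv, one_mul]

lemma KPair.uv_v {u v : G} (h : KPair u v) : u * v * v = u := by
  rw [mul_assoc, h.vv, mul_one]

lemma KPair.uv_u {u v : G} (h : KPair u v) : u * v * u = v := by
  rw [h.comm, mul_assoc, h.uu, mul_one]

lemma KPair.uv_uv {u v : G} (h : KPair u v) : u * v * (u * v) = 1 := by
  rw [← mul_assoc, h.uv_u, h.vv]

lemma KPair.uv_ne {u v : G} (h : KPair u v) : u * v ≠ 1 := by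
  intro h'
  apply h.uv
  rw [mul_eq_one_iff_eq_inv] at h'
  rw [h', inv_eq_iff_mul_eq_one, h.vv]

lemma KPair.step {u v : G} (h : KPair u v) : KPair u (u * v) :=
  ⟨h.uu, h.uv_uv, by rw [h.u_uv, h.uv_u], h.u1, h.uv_ne, by simpa using h.v1⟩

/-- The underlying set of the subgroup generated by a pair. -/
def kset (u v : G) : Set G := {1, u, v, u * v}

lemma KPair.kset_vu {u v : G} (h : KPair u v) : kset v u = kset u v := by
  ext x; simp only [kset, Set.mem_insert_iff, Set.mem_singleton_iff, h.comm]; tauto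

lemma KPair.kset_step {u v : G} (h : KPair u v) : kset u (u * v) = kset u v := by
  ext x; simp only [kset, Set.mem_insert_iff, Set.mem_singleton_iff, h.u_uv]; tauto

/-- The subgroup generated by a pair. -/
def KPair.sub {u v : G} (h : KPair u v) : Subgroup G where
  carrier := kset u v
  one_mem' := by simp [kset]
  inv_mem' := by
    have e1 : u⁻¹ = u := inv_eq_of_mul_eq_one_left h.uu
    have e2 : v⁻¹ = v := inv_eq_of_mul_eq_one_left h.vv
    have e3 : (u * v)⁻¹ = u * v := inv_eq_of_mul_eq_one_left h.uv_uv
    rintro x (rfl | rfl | rfl | rfl)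
    · simp [kset]
    · rw [e1]; simp [kset]
    · rw [e2]; simp [kset]
    · rw [e3]; simp [kset]
  mul_mem' := by
    rintro x y (rfl | rfl | rfl | rfl) (rfl | rfl | rfl | rfl) <;>
      simp only [kset, Set.mem_insert_iff, Set.mem_singleton_iff, h.uu, h.vv, h.u_uv, h.v_uv,
        h.uv_u, h.uv_v, h.uv_uv, ← h.comm, one_mul, mul_one, true_or, or_true]

lemma klein_exists (V : Subgroup G)
    (h : Nonempty (V ≃* (Multiplicative (ZMod 2) × Multiplicative (ZMod 2)))) :
    ∃ u v : G, KPair u v ∧ (V : Set G) = kset u v := by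
  obtain ⟨e⟩ := h
  let p : Multiplicative (ZMod 2) × Multiplicative (ZMod 2) := (Multiplicative.ofAdd 1, 1)
  let q : Multiplicative (ZMod 2) × Multiplicative (ZMod 2) := (1, Multiplicative.ofAdd 1)
  have hpq : KPair p q := ⟨by decide, by decide, by decide, by decide, by decide, by decide⟩
  have hall : ∀ r, r = 1 ∨ r = p ∨ r = q ∨ r = p * q := by decide
  have hinj : Function.Injective fun r => (e.symm r : G) :=
    Subtype.val_injective.comp e.symm.injective
  refine ⟨e.symm p, e.symm q, ⟨?_, ?_, ?_, ?_, ?_, ?_⟩, ?_⟩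
  · rw [← Subgroup.coe_mul, ← map_mul, hpq.uu]; simp
  · rw [← Subgroup.coe_mul, ← map_mul, hpq.vv]; simp
  · rw [← Subgroup.coe_mul, ← map_mul, hpq.comm, map_mul, Subgroup.coe_mul]
  · intro h; apply hpq.u1; apply hinj; simpa using h
  · intro h; apply hpq.v1; apply hinj; simpa using h
  · intro h; apply hpq.uv; apply hinj; simpa using h
  · ext x
    constructor
    · intro hx
      have hx' : x = (e.symm (e ⟨x, hx⟩) : G) := by simp
      rw [hx']
      rcases hall (e ⟨x, hx⟩) with h | h | h | h <;> rw [h] <;> simp [kset]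
    · rintro (rfl | rfl | rfl | rfl)
      · exact V.one_mem
      · exact (e.symm p).2
      · exact (e.symm q).2
      · exact V.mul_mem (e.symm p).2 (e.symm q).2

lemma KPair.ncard {u v : G} (h : KPair u v) : (kset u v).ncard = 4 := by
  have h1 := h.u1
  have h2 := h.v1
  have h3 := h.uv
  have h4 := h.uv_ne
  unfold kset
  rw [Set.ncard_insert_of_notMem, Set.ncard_insert_of_notMem, Set.ncard_pair]
  · intro h'; exact h1 (by simpa using h')
  · simp [h3, h2]
  · simp only [Set.mem_insert_iff, Set.mem_singleton_iff, not_or]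
    exact ⟨h1.symm, h2.symm, h4.symm⟩

lemma KPair.klein {u v : G} (h : KPair u v) :
    Nonempty (h.sub ≃* (Multiplicative (ZMod 2) × Multiplicative (ZMod 2))) := by
  have i1 : IsKleinFour (Multiplicative (ZMod 2) × Multiplicative (ZMod 2)) :=
    ⟨by simp [Nat.card_eq_fintype_card], by simp [Monoid.exponent_prod]⟩
  have hc : Nat.card h.sub = 4 := h.ncard
  have hnt : Nontrivial h.sub := by
    have : Finite h.sub := Nat.finite_of_card_ne_zero (by omega)
    exact Finite.one_lt_card_iff_nontrivial.mp (by omega)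
  have i2 : IsKleinFour h.sub := by
    refine ⟨hc, (Monoid.exponent_eq_prime_iff Nat.prime_two).mpr ?_⟩
    intro g hg
    apply orderOf_eq_prime _ hg
    obtain ⟨g, hg'⟩ := g
    ext
    simp only [pow_two, Subgroup.coe_mul, Subgroup.coe_one]
    rcases hg' with rfl | rfl | rfl | rfl
    · simp
    · exact h.uu
    · exact h.vv
    · exact h.uv_uv
  exact IsKleinFour.nonempty_mulEquiv

lemma six_pairs {Q : Type*} [Group Q] (hcm : ∀ s t : Q, s * t = t * s) (hQ : ∀ t : Q, t * t = 1) (a b c d : Q)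
    (h : kset a b = kset c d) :
    (a = c ∧ b = d) ∨ (a = d ∧ b = c) ∨ (a = c ∧ b = c * d) ∨ (a = d ∧ b = d * c) ∨
    (a = c * d ∧ b = c) ∨ (a = d * c ∧ b = d) := by
  have ha : a ∈ kset c d := by rw [← h]; simp [kset]
  have hb : b ∈ kset c d := by rw [← h]; simp [kset]
  have hc : c ∈ kset a b := by rw [h]; simp [kset]
  have hd : d ∈ kset a b := by rw [h]; simp [kset]
  have e1 := hQ c
  have e2 := hQ d
  have e3 := hQ (c * d)
  have e4 : c * (c * d) = d := by rw [← mul_assoc, e1, one_mul]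
  have e5 : d * (c * d) = c := by rw [hcm c, ← mul_assoc, e2, one_mul]
  have e6 := hcm c d
  have e7 : (c * d) * c = d := by rw [hcm, e4]
  have e8 : (c * d) * d = c := by rw [hcm, e5]
  have m1 := mul_one c
  have m2 := mul_one d
  have m3 := mul_one (c * d)
  have n1 := one_mul c
  have n2 := one_mul d
  have n3 := one_mul (c * d)
  have n4 := one_mul (1 : Q)
  simp only [kset, Set.mem_insert_iff, Set.mem_singleton_iff] at ha hb hc hd
  clear h hQ hcm
  rcases ha with ha | ha | ha | ha <;> rcases hb with hb | hb | hb | hb <;> grind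

lemma klein_T {Q : Type*} [Group Q] (hcm : ∀ s t : Q, s * t = t * s) (hQ : ∀ t : Q, t * t = 1) (T : Subgroup Q)
    (hT : Nat.card T = 1 ∨ Nat.card T = 2 ∨ Nat.card T = 4) : ∃ a b : Q, (T : Set Q) = kset a b := by
  have hTc : Nat.card T = (T : Set Q).ncard := rfl
  have hfin : (T : Set Q).Finite := Set.finite_of_ncard_pos (by omega)
  rcases hT with h | h | h
  · refine ⟨1, 1, ?_⟩
    rw [Subgroup.card_eq_one] at h
    simp [h, kset]
  · obtain ⟨t, ht, ht1⟩ := Set.exists_mem_notMem_of_ncard_lt_ncard (s := {1}) (t := (T : Set Q))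
      (by rw [Set.ncard_singleton]; omega)
    refine ⟨t, 1, ?_⟩
    have e : kset t 1 = {1, t} := by
      ext x; simp only [kset, Set.mem_insert_iff, Set.mem_singleton_iff, mul_one]; tauto
    rw [e]
    symm
    apply Set.eq_of_subset_of_ncard_le _ _ hfin
    · rintro x (rfl | rfl)
      · exact T.one_mem
      · exact ht
    · rw [Set.ncard_pair (fun h => ht1 (by simp [h]))]; omega
  · obtain ⟨t, ht, ht1⟩ := Set.exists_mem_notMem_of_ncard_lt_ncard (s := {1}) (t := (T : Set Q))
      (by rw [Set.ncard_singleton]; omega)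
    have ht1' : t ≠ 1 := by simpa using ht1
    obtain ⟨s, hs, hs1⟩ := Set.exists_mem_notMem_of_ncard_lt_ncard (s := {1, t}) (t := (T : Set Q))
      (by rw [Set.ncard_pair ht1'.symm]; omega)
    simp only [Set.mem_insert_iff, Set.mem_singleton_iff, not_or] at hs1
    have hk : KPair t s := ⟨hQ t, hQ s, hcm _ _, ht1', hs1.1, fun h => hs1.2 h.symm⟩
    refine ⟨t, s, ?_⟩
    symm
    apply Set.eq_of_subset_of_ncard_le _ _ hfin
    · rintro x (rfl | rfl | rfl | rfl)
      · exact T.one_mem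
      · exact ht
      · exact hs
      · exact T.mul_mem ht hs
    · rw [hk.ncard]; omega

lemma image_kset {H : Type*} [Group H] (f : G →* H) (u v : G) :
    f '' kset u v = kset (f u) (f v) := by
  simp [kset, Set.image_insert_eq]

end grp

lemma sq_one (t : Kxˣ ⧸ sqSubgroup) : t * t = 1 := by
  obtain ⟨k, rfl⟩ := QuotientGroup.mk_surjective t
  rw [← QuotientGroup.mk_mul, QuotientGroup.eq_one_iff]
  exact ⟨k, by simp [pow_two]⟩

lemma q_comm (s t : Kxˣ ⧸ sqSubgroup) : s * t = t * s := by
  obtain ⟨k, rfl⟩ := QuotientGroup.mk_surjective s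
  obtain ⟨l, rfl⟩ := QuotientGroup.mk_surjective t
  rw [← QuotientGroup.mk_mul, mul_comm, QuotientGroup.mk_mul]

lemma conj_of_pairs {u v u' v' : PGL2Kx} (h : KPair u v) (h' : KPair u' v')
    (e1 : detHom u = detHom u') (e2 : detHom v = detHom v') :
    ∃ g : PGL2Kx, g * u * g⁻¹ = u' ∧ g * v * g⁻¹ = v' := by
  obtain ⟨α, hα⟩ := QuotientGroup.mk_surjective (detHom u)
  obtain ⟨β, hβ⟩ := QuotientGroup.mk_surjective (detHom v)
  obtain ⟨u₀, v₀, -, -, -, H⟩ := exists_nf α β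
  obtain ⟨g, g1, g2⟩ := H u v h hα.symm hβ.symm
  obtain ⟨k, k1, k2⟩ := H u' v' h' (by rw [← e1, hα]) (by rw [← e2, hβ])
  rw [← eq_mul_inv_iff_mul_eq] at g1 g2 k1 k2
  refine ⟨k * g⁻¹, ?_, ?_⟩
  · rw [g1, k1]; group
  · rw [g2, k2]; group

/-- The map `det : PGL(2, ℂ(x)) → ℂ(x)*/(ℂ(x)*)²` induces a bijection between
conjugacy classes of subgroups of `PGL(2, ℂ(x))` isomorphic to `(ℤ/2)²` and
subgroups of `ℂ(x)*/(ℂ(x)*)²` of order `≤ 4` (i.e. of order `1`, `2` or `4`):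
the `det`-image of a Klein four-subgroup is such a subgroup, two Klein
four-subgroups are conjugate iff they have the same `det`-image, and every
subgroup of order `≤ 4` arises this way. -/
theorem stmt_19 :
    (∀ V : Subgroup PGL2Kx, IsKlein4Subgroup V →
      ∃ T : Subgroup (Kxˣ ⧸ sqSubgroup),
        (↑T : Set (Kxˣ ⧸ sqSubgroup)) = detBar '' ↑V ∧
        (Nat.card T = 1 ∨ Nat.card T = 2 ∨ Nat.card T = 4)) ∧
    (∀ V W : Subgroup PGL2Kx, IsKlein4Subgroup V → IsKlein4Subgroup W →
      ((∃ g : PGL2Kx, Subgroup.map (MulAut.conj g).toMonoidHom V = W) ↔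
        detBar '' ↑V = detBar '' ↑W)) ∧
    (∀ T : Subgroup (Kxˣ ⧸ sqSubgroup),
      (Nat.card T = 1 ∨ Nat.card T = 2 ∨ Nat.card T = 4) →
      ∃ V : Subgroup PGL2Kx, IsKlein4Subgroup V ∧
        detBar '' ↑V = (↑T : Set (Kxˣ ⧸ sqSubgroup))) := by
  rw [detBar_eq]
  refine ⟨?_, ?_, ?_⟩
  · intro V hV
    refine ⟨V.map detHom, Subgroup.coe_map _ _, ?_⟩
    obtain ⟨u, v, huv, hs⟩ := klein_exists V hV
    have hc : Nat.card V = 4 := by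
      change (V : Set PGL2Kx).ncard = 4
      rw [hs, huv.ncard]
    have hd : Nat.card (V.map detHom) ∣ 4 := by
      rw [← hc]; exact Subgroup.card_map_dvd V detHom
    have hle := Nat.le_of_dvd (by norm_num) hd
    interval_cases Nat.card (V.map detHom) <;> omega
  · intro V W hV hW
    constructor
    · rintro ⟨g, rfl⟩
      rw [Subgroup.coe_map, Set.image_image]
      apply Set.image_congr
      intro x _
      simp only [MulEquiv.toMonoidHom_eq_coe, MonoidHom.coe_coe, MulAut.conj_apply, map_mul, map_inv]
      rw [q_comm (detHom g), mul_inv_cancel_right]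
    · intro h
      obtain ⟨u, v, huv, hs⟩ := klein_exists V hV
      obtain ⟨p, q, hpq, ht⟩ := klein_exists W hW
      rw [hs, ht, image_kset, image_kset] at h
      have key : ∃ p' q', KPair p' q' ∧ kset p' q' = kset p q ∧ detHom u = detHom p' ∧
          detHom v = detHom q' := by
        have hqp := hpq.vu
        rcases six_pairs q_comm sq_one _ _ _ _ h with h | h | h | h | h | h
        · exact ⟨p, q, hpq, rfl, h⟩
        · exact ⟨q, p, hqp, hpq.kset_vu, h⟩
        · exact ⟨p, p * q, hpq.step, hpq.kset_step, by rwa [map_mul]⟩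
        · exact ⟨q, q * p, hqp.step, hqp.kset_step.trans hpq.kset_vu, by rwa [map_mul]⟩
        · exact ⟨p * q, p, hpq.step.vu, hpq.step.kset_vu.trans hpq.kset_step, by rwa [map_mul]⟩
        · exact ⟨q * p, q, hqp.step.vu,
            (hqp.step.kset_vu.trans hqp.kset_step).trans hpq.kset_vu, by rwa [map_mul]⟩
      obtain ⟨p', q', hpq', hk, d1, d2⟩ := key
      obtain ⟨g, g1, g2⟩ := conj_of_pairs huv hpq' d1 d2
      refine ⟨g, ?_⟩
      apply SetLike.coe_injective
      rw [Subgroup.coe_map, hs, image_kset, ht, ← hk]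
      simp only [MulEquiv.toMonoidHom_eq_coe, MonoidHom.coe_coe, MulAut.conj_apply, g1, g2]
  · intro T hT
    obtain ⟨a, b, hab⟩ := klein_T q_comm sq_one T hT
    obtain ⟨α, rfl⟩ := QuotientGroup.mk_surjective a
    obtain ⟨β, rfl⟩ := QuotientGroup.mk_surjective b
    obtain ⟨u, v, huv, hu, hv, -⟩ := exists_nf α β
    refine ⟨huv.sub, huv.klein, ?_⟩
    rw [hab, ← hu, ← hv, ← image_kset]
    rfl
end
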